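/- arXiv:2202.06758 — 6 statements merged into one kernel-verified Lean document; each statement's English description precedes it below -/
import Mathlib

section
/- Orthogonality of the generator and parity-check Moore matrices of a linearized Reed–Solomon code: let n = n_1 + ⋯ + n_ℓ, let ξ_1, …, ξ_ℓ ∈ K be nonzero, let β_κ^{(i)}, α_κ^{(i)} ∈ K for i = 1, …, ℓ and κ = 1, …, n_i, and suppose that Σ_{i=1}^ℓ Σ_{κ=1}^{n_i} α_κ^{(i)} · σ^{l-1}(β_κ^{(i)}) · ∏_{j=0}^{l-2} σ^j(ξ_i) = 0 for all l = 1, …, n−1. Then for every 1 ≤ k < n, every u = 1, …, k and every v = 1, …, n−k: Σ_{i=1}^ℓ Σ_{κ=1}^{n_i} σ^{u-1}(β_κ^{(i)}) · ∏_{j=0}^{u-2} σ^j(ξ_i) · σ^{-(v-1)}(α_κ^{(i)}) · ∏_{j=1}^{v-1} σ^{-j}(ξ_i) = 0. Equivalently, G·H^T = 0 where G is the k×n generalized Moore matrix built from β with parameters ξ_i and automorphism σ, and H is the (n−k)×n generalized Moore matrix built from α with parameters σ^{-1}(ξ_i) and automorphism σ^{-1}; thus H is a parity-check matrix compatible with the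 generator matrix G. -/
/-- Applying `σ ^ b` undoes `j ≤ b` applications of `σ.symm`. -/
theorem RingEquiv.pow_apply_symm_pow_apply {R : Type*} [Semiring R] (σ : R ≃+* R)
    {j b : ℕ} (hj : j ≤ b) (x : R) :
    (σ ^ b) ((σ.symm ^ j) x) = (σ ^ (b - j)) x := by
  rw [← RingAut.mul_apply]
  change (σ ^ b * σ⁻¹ ^ j) x = _
  rw [inv_pow, pow_sub σ hj]

/-- Applying `σ ^ b` to `∏_{j < a} σ^j(x) · ∏_{1 ≤ j ≤ b} σ^{-j}(x)` gives the product
of `σ^j(x)` over `j < b + a`. -/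
theorem RingEquiv.pow_prod_mul_pow_prod_symm {R : Type*} [CommSemiring R] (σ : R ≃+* R)
    (a b : ℕ) (x : R) :
    (σ ^ b) (∏ j ∈ Finset.range a, (σ ^ j) x) *
        (σ ^ b) (∏ j ∈ Finset.Icc 1 b, (σ.symm ^ j) x) =
      ∏ j ∈ Finset.range (b + a), (σ ^ j) x := by
  have hneg : (σ ^ b) (∏ j ∈ Finset.Icc 1 b, (σ.symm ^ j) x) =
      ∏ j ∈ Finset.range b, (σ ^ j) x := by
    rw [map_prod]
    refine Finset.prod_bij' (fun j _ => b - j) (fun j _ => b - j) ?_ ?_ ?_ ?_ ?_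
    · intro j hj; simp only [Finset.mem_Icc, Finset.mem_range] at *; omega
    · intro j hj; simp only [Finset.mem_Icc, Finset.mem_range] at *; omega
    · intro j hj; simp only [Finset.mem_Icc] at hj; omega
    · intro j hj; simp only [Finset.mem_range] at hj; omega
    · intro j hj
      exact σ.pow_apply_symm_pow_apply (Finset.mem_Icc.mp hj).2 x
  rw [hneg, map_prod, Finset.prod_range_add, mul_comm]
  simp only [pow_add, RingAut.mul_apply]

/-- Orthogonality of the generator and parity-check Moore matrices of a linearized
Reed–Solomon code.  `N = n₁ + ⋯ + n_ℓ`, the `ξ i` are nonzero, and the vectors `α, β`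
satisfy the `n-1` syndrome-type equations.  Then for every `1 ≤ k < N` the `u`-th row of
the generalized Moore matrix `G` built from `β` (parameters `ξ i`, automorphism `σ`) is
orthogonal to the `v`-th row of the generalized Moore matrix `H` built from `α`
(parameters `σ⁻¹(ξ i)`, automorphism `σ⁻¹`), i.e. `G · Hᵀ = 0`. -/
theorem moore_matrix_orthogonality {K : Type*} [Field K] (σ : K ≃+* K)
    (ℓ : ℕ) (n : Fin ℓ → ℕ) (N : ℕ) (hN : N = ∑ i, n i)
    (ξ : Fin ℓ → K) (hξ : ∀ i, ξ i ≠ 0)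
    (β α : (i : Fin ℓ) → Fin (n i) → K)
    (horth : ∀ l ∈ Finset.Icc 1 (N - 1),
      ∑ i, ∑ κ, α i κ * (σ ^ (l - 1)) (β i κ) *
        ∏ j ∈ Finset.range (l - 1), (σ ^ j) (ξ i) = 0) :
    ∀ k : ℕ, 1 ≤ k → k < N →
      ∀ u ∈ Finset.Icc 1 k, ∀ v ∈ Finset.Icc 1 (N - k),
        ∑ i, ∑ κ, (σ ^ (u - 1)) (β i κ) *
            (∏ j ∈ Finset.range (u - 1), (σ ^ j) (ξ i)) *
            ((σ.symm ^ (v - 1)) (α i κ)) *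
            ∏ j ∈ Finset.Icc 1 (v - 1), (σ.symm ^ j) (ξ i) = 0 := by
  intro k _ hkN u hu v hv
  rw [Finset.mem_Icc] at hu hv
  obtain ⟨a, rfl⟩ : ∃ a, u = a + 1 := ⟨u - 1, by omega⟩
  obtain ⟨b, rfl⟩ : ∃ b, v = b + 1 := ⟨v - 1, by omega⟩
  simp only [Nat.add_sub_cancel]
  have h := horth (b + a + 1) (Finset.mem_Icc.mpr ⟨by omega, by omega⟩)
  rw [Nat.add_sub_cancel] at h
  apply (σ ^ b).injective
  rw [map_zero, ← h, map_sum]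
  refine Finset.sum_congr rfl fun i _ => ?_
  rw [map_sum]
  refine Finset.sum_congr rfl fun κ _ => ?_
  rw [← σ.pow_prod_mul_pow_prod_symm a b (ξ i), map_mul, map_mul, map_mul,
    σ.pow_apply_symm_pow_apply le_rfl, Nat.sub_self, pow_zero, RingAut.one_apply,
    pow_add, RingAut.mul_apply]
  ring
end

section
/- Product of a skew polynomial with the syndrome (equation (40) of the proof of the ESP key equation): let λ_1, …, λ_{d+1} ∈ K be any coefficient sequence. Then for every integer l ≥ d+1: Σ_{ν=1}^{d+1} λ_ν · σ^{-(ν-1)}(s_{l-ν+1}) = Σ_{i=1}^ℓ Σ_{r=1}^{t_i} [ Σ_{ν=1}^{d+1} λ_ν · σ^{-(ν-1)}(a_r^{(i)}) · ∏_{j=1}^{ν-1} σ^{-j}(ξ_i)^{-1} ] · σ^{-(l-1)}(x_r^{(i)}) · ∏_{j=1}^{l-1} σ^{-j}(ξ_i); that is, the l-th coefficient of the skew product (with respect to σ^{-1}) of λ with the syndrome polynomial equals the sum over all errors of (the generalized operator evaluation of λ at the error value a_r^{(i)} with respect to σ^{-1} and parameter σ^{-1}(ξ_i^{-1})) times σ^{-(l-1)}(x_r^{(i)})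 · ∏_{j=1}^{l-1} σ^{-j}(ξ_i). -/
/-- The norm-type products `∏_{j=1}^{n} τ^j(c)` satisfy a twisted multiplicativity in `n`. -/
theorem prod_Icc_pow_apply_add {K : Type*} [Field K] (τ : K ≃+* K) (c : K) (m n : ℕ) :
    ∏ j ∈ Finset.Icc 1 (m + n), (τ ^ j) c =
      (∏ j ∈ Finset.Icc 1 m, (τ ^ j) c) * (τ ^ m) (∏ j ∈ Finset.Icc 1 n, (τ ^ j) c) := by
  induction n with
  | zero => simp
  | succ n ih =>
    rw [← add_assoc, Finset.prod_Icc_succ_top (by omega), ih,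
      Finset.prod_Icc_succ_top (by omega), map_mul, add_assoc, pow_add τ m (n + 1),
      RingAut.mul_apply, mul_assoc]

/-- Equation (40) in the proof of the ESP key equation: the `l`-th coefficient of the
skew product (with respect to `σ⁻¹`) of a coefficient sequence `lam` (of degree `≤ d`)
with the syndrome polynomial equals the sum over all errors of the generalized operator
evaluation of `lam` at the error value `a_r^{(i)}` (with respect to `σ⁻¹` and evaluation
parameter `σ⁻¹(ξ_i⁻¹)`) times `σ^{-(l-1)}(x_r^{(i)}) · ∏_{j=1}^{l-1} σ^{-j}(ξ_i)`. -/
theorem skew_poly_times_syndrome_coeff {K : Type*} [Field K] (σ : K ≃+* K)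
    (ℓ : ℕ) (t : Fin ℓ → ℕ)
    (ξ : Fin ℓ → K) (hξ : ∀ i, ξ i ≠ 0)
    (a x : (i : Fin ℓ) → Fin (t i) → K)
    (s : ℕ → K)
    (hs : ∀ l : ℕ, 1 ≤ l → s l =
      ∑ i, ∑ r, a i r * (σ.symm ^ (l - 1)) (x i r) *
        ∏ j ∈ Finset.Icc 1 (l - 1), (σ.symm ^ j) (ξ i))
    (d : ℕ) (lam : ℕ → K) :
    ∀ l : ℕ, d + 1 ≤ l →
      ∑ ν ∈ Finset.Icc 1 (d + 1), lam ν * (σ.symm ^ (ν - 1)) (s (l - ν + 1))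
        = ∑ i, ∑ r,
            (∑ ν ∈ Finset.Icc 1 (d + 1), lam ν * (σ.symm ^ (ν - 1)) (a i r) *
                ∏ j ∈ Finset.Icc 1 (ν - 1), ((σ.symm ^ j) (ξ i))⁻¹)
            * (σ.symm ^ (l - 1)) (x i r) *
              ∏ j ∈ Finset.Icc 1 (l - 1), (σ.symm ^ j) (ξ i) := by
  intro l hl
  have hterm : ∀ ν ∈ Finset.Icc 1 (d + 1),
      lam ν * (σ.symm ^ (ν - 1)) (s (l - ν + 1)) =
        ∑ i, ∑ r, lam ν * (σ.symm ^ (ν - 1)) (a i r) *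
          (∏ j ∈ Finset.Icc 1 (ν - 1), ((σ.symm ^ j) (ξ i))⁻¹) *
          (σ.symm ^ (l - 1)) (x i r) * ∏ j ∈ Finset.Icc 1 (l - 1), (σ.symm ^ j) (ξ i) := by
    intro ν hν
    rw [Finset.mem_Icc] at hν
    obtain ⟨m, rfl⟩ : ∃ m, ν = m + 1 := ⟨ν - 1, by omega⟩
    obtain ⟨n, rfl⟩ : ∃ n, l = m + n + 1 := ⟨l - m - 1, by omega⟩
    rw [hs _ (by omega), show m + n + 1 - (m + 1) + 1 - 1 = n by omega]
    simp only [Nat.add_sub_cancel, map_sum, Finset.mul_sum]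
    refine Finset.sum_congr rfl fun i _ => Finset.sum_congr rfl fun r _ => ?_
    have hne : ∏ j ∈ Finset.Icc 1 m, (σ.symm ^ j) (ξ i) ≠ 0 :=
      Finset.prod_ne_zero_iff.mpr fun j _ =>
        (map_ne_zero_iff _ (σ.symm ^ j).injective).mpr (hξ i)
    rw [prod_Icc_pow_apply_add, Finset.prod_inv_distrib, map_mul, map_mul, pow_add,
      RingAut.mul_apply]
    field_simp
  rw [Finset.sum_congr rfl hterm, Finset.sum_comm]
  refine Finset.sum_congr rfl fun i _ => ?_
  rw [Finset.sum_comm]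
  refine Finset.sum_congr rfl fun r _ => ?_
  rw [Finset.sum_mul, Finset.sum_mul]
end

section
/- Factorization of the coefficients of the product Λ·s·Λ̂_C (final display in the proof of the ESP key equation): let λ_1, …, λ_{d+1} ∈ K and Λ_{C,1}, …, Λ_{C,γ+1} ∈ K be coefficient sequences, and define u_μ := Σ_{ν=1}^{d+1} λ_ν · σ^{-(ν-1)}(s_{μ-ν+1}) for μ ≥ d+1. Then for every integer l ≥ d+γ+1: Σ_{ν=1}^{γ+1} u_{l-ν+1} · σ^{γ+1-l}(Λ_{C,γ-ν+2}) = Σ_{i=1}^ℓ Σ_{r=1}^{t_i} E_r^{(i)} · σ^{-(l-γ-1)}( L_r^{(i)} · ∏_{j=0}^{l-γ-2} σ^{j}(ξ_i) ), where E_r^{(i)} := Σ_{ν=1}^{d+1} λ_ν · σ^{-(ν-1)}(a_r^{(i)}) · ∏_{j=1}^{ν-1} σ^{-j}(ξ_i)^{-1} and L_r^{(i)} := Σ_{μ=1}^{γ+1} Λ_{C,μ} · σ^{-(μ-1)}(x_r^{(i)}) · ∏_{j=1}^{μ-1} σ^{-j}(ξ_i). (Here σ^{γ+1-l}(Λ_{C,γ-ν+2})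 is the ν-th coefficient of the σ^{-1}-reverse of Λ_C with respect to γ, shifted as in right skew multiplication by x^{l-ν}.) -/
/-- Splitting rule for the generalized norms `∏_{j=1}^{n} τ^j(c)`. -/
theorem RingEquiv.pow_apply_prod_Icc_mul_prod_Icc {K : Type*} [CommSemiring K] (τ : K ≃+* K)
    (c : K) (m n : ℕ) :
    (τ ^ m) (∏ j ∈ Finset.Icc 1 n, (τ ^ j) c) * ∏ j ∈ Finset.Icc 1 m, (τ ^ j) c =
      ∏ j ∈ Finset.Icc 1 (m + n), (τ ^ j) c := by
  induction n with
  | zero => simp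
  | succ n ih =>
    rw [Finset.prod_Icc_succ_top (by omega), ← add_assoc,
      Finset.prod_Icc_succ_top (by omega), ← ih, map_mul, ← RingAut.mul_apply, ← pow_add]
    ring_nf

theorem RingEquiv.symm_pow_apply_prod_range {K : Type*} [CommSemiring K] (σ : K ≃+* K)
    (c : K) (n : ℕ) :
    (σ.symm ^ n) (∏ j ∈ Finset.range n, (σ ^ j) c) =
      ∏ j ∈ Finset.Icc 1 n, (σ.symm ^ j) c := by
  induction n with
  | zero => simp
  | succ n ih =>
    have cancel : (σ.symm ^ n) ((σ ^ n) c) = c := by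
      rw [← RingAut.mul_apply, show σ.symm = σ⁻¹ from rfl, inv_pow, inv_mul_cancel,
        RingAut.one_apply]
    rw [Finset.prod_range_succ, pow_succ', RingAut.mul_apply, map_mul, ih, cancel, add_comm n 1,
      ← RingEquiv.pow_apply_prod_Icc_mul_prod_Icc]
    simp

/-- The image under `τ^k` of a syndrome term `a τ^n(x) ∏_{j=1}^{n} τ^j(c)` is a factor depending
only on `a` and `k` times a factor depending only on `x` and `k + n`. -/
theorem RingEquiv.pow_apply_syndrome_term {K : Type*} [Field K] (τ : K ≃+* K)
    {c : K} (hc : c ≠ 0) (a x : K) (k n : ℕ) :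
    (τ ^ k) (a * (τ ^ n) x * ∏ j ∈ Finset.Icc 1 n, (τ ^ j) c) =
      ((τ ^ k) a * ∏ j ∈ Finset.Icc 1 k, ((τ ^ j) c)⁻¹) *
        ((τ ^ (k + n)) x * ∏ j ∈ Finset.Icc 1 (k + n), (τ ^ j) c) := by
  have hne : ∏ j ∈ Finset.Icc 1 k, (τ ^ j) c ≠ 0 :=
    Finset.prod_ne_zero_iff.2 fun j _ => (map_ne_zero _).2 hc
  rw [map_mul, map_mul, ← RingAut.mul_apply, ← pow_add, Finset.prod_inv_distrib,
    ← RingEquiv.pow_apply_prod_Icc_mul_prod_Icc τ c k n]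
  field_simp

/-- Factorization of the coefficients of the product `Λ · s · Λ̂_C` (final display in the
proof of the ESP key equation).  Here `lam` has degree `≤ d`, `ΛC` has degree `≤ γ`,
`u μ` is the `μ`-th coefficient of the skew product (w.r.t. `σ⁻¹`) of `lam` with the
syndrome polynomial, and `σ^{γ+1-l}(ΛC_{γ-ν+2})` is written as
`(σ.symm ^ (l - γ - 1)) (ΛC (γ + 2 - ν))`.  The right-hand side factors through the
generalized operator evaluations `E_r^{(i)}` of `lam` at the error values and
`L_r^{(i)}` of `ΛC` at the error locators. -/
theorem esp_product_coefficient_factorization {K : Type*} [Field K] (σ : K ≃+* K)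
    (ℓ : ℕ) (t : Fin ℓ → ℕ)
    (ξ : Fin ℓ → K) (hξ : ∀ i, ξ i ≠ 0)
    (a x : (i : Fin ℓ) → Fin (t i) → K)
    (s : ℕ → K)
    (hs : ∀ l : ℕ, 1 ≤ l → s l =
      ∑ i, ∑ r, a i r * (σ.symm ^ (l - 1)) (x i r) *
        ∏ j ∈ Finset.Icc 1 (l - 1), (σ.symm ^ j) (ξ i))
    (d γ : ℕ) (lam ΛC : ℕ → K) (u : ℕ → K)
    (hu : ∀ μ : ℕ, d + 1 ≤ μ → u μ =
      ∑ ν ∈ Finset.Icc 1 (d + 1), lam ν * (σ.symm ^ (ν - 1)) (s (μ - ν + 1))) :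
    ∀ l : ℕ, d + γ + 1 ≤ l →
      ∑ ν ∈ Finset.Icc 1 (γ + 1),
          u (l - ν + 1) * (σ.symm ^ (l - γ - 1)) (ΛC (γ + 2 - ν))
        = ∑ i, ∑ r,
            (∑ ν ∈ Finset.Icc 1 (d + 1), lam ν * (σ.symm ^ (ν - 1)) (a i r) *
                ∏ j ∈ Finset.Icc 1 (ν - 1), ((σ.symm ^ j) (ξ i))⁻¹)
            * (σ.symm ^ (l - γ - 1))
                ((∑ μ ∈ Finset.Icc 1 (γ + 1), ΛC μ * (σ.symm ^ (μ - 1)) (x i r) *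
                    ∏ j ∈ Finset.Icc 1 (μ - 1), (σ.symm ^ j) (ξ i)) *
                  ∏ j ∈ Finset.range (l - γ - 1), (σ ^ j) (ξ i)) := by
  intro l hl
  obtain ⟨N, rfl⟩ : ∃ N, l = N + γ + 1 := ⟨l - γ - 1, by omega⟩
  have hN : N + γ + 1 - γ - 1 = N := by omega
  rw [hN]
  obtain ⟨E, hE⟩ : ∃ E : (i : Fin ℓ) → Fin (t i) → K, ∀ i r, E i r =
      ∑ ν ∈ Finset.Icc 1 (d + 1), lam ν * (σ.symm ^ (ν - 1)) (a i r) *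
        ∏ j ∈ Finset.Icc 1 (ν - 1), ((σ.symm ^ j) (ξ i))⁻¹ := ⟨_, fun _ _ => rfl⟩
  simp_rw [← hE]
  have hu_factor : ∀ n : ℕ, d ≤ n → u (n + 1) = ∑ i, ∑ r,
      E i r *
      ((σ.symm ^ n) (x i r) * ∏ j ∈ Finset.Icc 1 n, (σ.symm ^ j) (ξ i)) := by
    intro n hn
    simp_rw [hu (n + 1) (by omega), hE, Finset.sum_mul]
    rw [Finset.sum_congr rfl fun i _ => Finset.sum_comm, Finset.sum_comm]
    refine Finset.sum_congr rfl fun ν hν => ?_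
    rw [Finset.mem_Icc] at hν
    rw [hs _ (by omega), map_sum, Finset.mul_sum]
    refine Finset.sum_congr rfl fun i _ => ?_
    rw [map_sum, Finset.mul_sum]
    refine Finset.sum_congr rfl fun r _ => ?_
    rw [RingEquiv.pow_apply_syndrome_term _ (hξ i),
      show ν - 1 + (n + 1 - ν + 1 - 1) = n by omega]
    ring
  calc
    _ = ∑ μ ∈ Finset.Icc 1 (γ + 1), u (N + (μ - 1) + 1) * (σ.symm ^ N) (ΛC μ) := by
      refine Finset.sum_nbij' (fun ν => γ + 2 - ν) (fun μ => γ + 2 - μ) ?_ ?_ ?_ ?_ ?_ <;>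
        intro ν hν <;> rw [Finset.mem_Icc] at hν
      · rw [Finset.mem_Icc]; omega
      · rw [Finset.mem_Icc]; omega
      · omega
      · omega
      · rw [show N + γ + 1 - ν + 1 = N + (γ + 2 - ν - 1) + 1 by omega]
    _ = _ := by
      rw [Finset.sum_congr rfl fun μ _ => by rw [hu_factor (N + (μ - 1)) (by omega)]]
      simp_rw [Finset.sum_mul _ _ ((σ.symm ^ N) (ΛC _))]
      rw [Finset.sum_comm]
      refine Finset.sum_congr rfl fun i _ => ?_
      rw [Finset.sum_comm]
      refine Finset.sum_congr rfl fun r _ => ?_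
      rw [map_mul, map_sum, RingEquiv.symm_pow_apply_prod_range, Finset.sum_mul, Finset.mul_sum]
      refine Finset.sum_congr rfl fun μ _ => ?_
      rw [← RingEquiv.pow_apply_prod_Icc_mul_prod_Icc, map_mul, map_mul, pow_add,
        RingAut.mul_apply]
      ring
end

section
/- Product of a skew polynomial with the reversed syndrome (equation (45) of the proof of the ELP key equation): fix an integer N ≥ 1 (in the paper N = n−k) and define the reversed syndrome s̃_μ := σ^{N-μ}(s_{N-μ+1}) for μ = 1, …, N. Let λ_1, …, λ_{d+1} ∈ K be any coefficient sequence. Then for every integer l with d+1 ≤ l ≤ N: Σ_{ν=1}^{d+1} λ_ν · σ^{-(ν-1)}(s̃_{l-ν+1}) = Σ_{i=1}^ℓ Σ_{r=1}^{t_i} [ Σ_{ν=1}^{d+1} λ_ν · σ^{-(ν-1)}(x_r^{(i)}) · ∏_{j=1}^{ν-1} σ^{-j}(ξ_i) ] · σ^{N-l}(a_r^{(i)}) · ∏_{j=0}^{N-l-1} σ^{j}(ξ_i); that is, the l-th coefficient of the skew product (with respect to σ^{-1}) of λ with the σ^{-1}-reverse of the syndrome polynomial equals the sum over all errors of (the generalized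 operator evaluation of λ at the error locator x_r^{(i)} with respect to σ^{-1} and parameter σ^{-1}(ξ_i)) times σ^{N-l}(a_r^{(i)}) · ∏_{j=0}^{N-l-1} σ^{j}(ξ_i). -/
/-- Applying `σ` to `∏_{j=1}^{p+1} σ⁻ʲ c` shifts the exponents by one. -/
lemma map_prod_Icc_symm_pow_succ {K : Type*} [Field K] (σ : K ≃+* K) (c : K) (p : ℕ) :
    σ (∏ j ∈ Finset.Icc 1 (p + 1), (σ.symm ^ j) c)
      = c * ∏ j ∈ Finset.Icc 1 p, (σ.symm ^ j) c := by
  have h (j : ℕ) : σ ((σ.symm ^ (j + 1)) c) = (σ.symm ^ j) c := by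
    rw [pow_succ']
    exact σ.apply_symm_apply _
  induction p with
  | zero => simp
  | succ p ih =>
    rw [Finset.prod_Icc_succ_top (by omega), map_mul, ih, h,
      Finset.prod_Icc_succ_top (by omega), mul_assoc]

/-- Applying `σᵐ` to `∏_{j=1}^{m+p} σ⁻ʲ c` splits it into its negative and nonnegative
exponents. -/
lemma pow_map_prod_Icc_symm_pow {K : Type*} [Field K] (σ : K ≃+* K) (c : K) (m p : ℕ) :
    (σ ^ m) (∏ j ∈ Finset.Icc 1 (m + p), (σ.symm ^ j) c)
      = (∏ j ∈ Finset.Icc 1 p, (σ.symm ^ j) c) * ∏ j ∈ Finset.range m, (σ ^ j) c := by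
  induction m generalizing p with
  | zero => simp
  | succ m ih =>
    have h (j : ℕ) : σ ((σ ^ j) c) = (σ ^ (j + 1)) c := by
      rw [pow_succ']
      rfl
    have h' (y : K) : (σ ^ (m + 1)) y = σ ((σ ^ m) y) := by
      rw [pow_succ']
      rfl
    rw [h', show m + 1 + p = m + (p + 1) by ring, ih, map_mul, map_prod_Icc_symm_pow_succ,
      map_prod, Finset.prod_range_succ']
    simp only [h, pow_zero, RingAut.one_apply]
    ring

lemma symm_pow_apply_pow_add {K : Type*} [Field K] (σ : K ≃+* K) (m p : ℕ) (y : K) :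
    (σ.symm ^ p) ((σ ^ (m + p)) y) = (σ ^ m) y := by
  have h : σ.symm ^ p * σ ^ (m + p) = σ ^ m := by
    change σ⁻¹ ^ p * σ ^ (m + p) = σ ^ m
    rw [add_comm, pow_add, inv_pow, inv_mul_cancel_left]
  exact DFunLike.congr_fun h y

lemma pow_apply_symm_pow_add {K : Type*} [Field K] (σ : K ≃+* K) (m p : ℕ) (y : K) :
    (σ ^ m) ((σ.symm ^ (m + p)) y) = (σ.symm ^ p) y := by
  have h : σ ^ m * σ.symm ^ (m + p) = σ.symm ^ p := by
    change σ ^ m * σ⁻¹ ^ (m + p) = σ⁻¹ ^ p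
    rw [pow_add, inv_pow, mul_inv_cancel_left]
  exact DFunLike.congr_fun h y

/-- Equation (45) in the proof of the ELP key equation: with the reversed syndrome
`s̃_μ = σ^{N-μ}(s_{N-μ+1})` for `1 ≤ μ ≤ N`, the `l`-th coefficient (for `d+1 ≤ l ≤ N`)
of the skew product (w.r.t. `σ⁻¹`) of a coefficient sequence `lam` of degree `≤ d` with
the `σ⁻¹`-reverse of the syndrome polynomial equals the sum over all errors of the
generalized operator evaluation of `lam` at the error locator `x_r^{(i)}` (w.r.t. `σ⁻¹`,
parameter `σ⁻¹(ξ_i)`) times `σ^{N-l}(a_r^{(i)}) · ∏_{j=0}^{N-l-1} σ^{j}(ξ_i)`. -/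
theorem skew_poly_times_reversed_syndrome_coeff {K : Type*} [Field K] (σ : K ≃+* K)
    (ℓ : ℕ) (t : Fin ℓ → ℕ)
    (ξ : Fin ℓ → K) (hξ : ∀ i, ξ i ≠ 0)
    (a x : (i : Fin ℓ) → Fin (t i) → K)
    (s : ℕ → K)
    (hs : ∀ l : ℕ, 1 ≤ l → s l =
      ∑ i, ∑ r, a i r * (σ.symm ^ (l - 1)) (x i r) *
        ∏ j ∈ Finset.Icc 1 (l - 1), (σ.symm ^ j) (ξ i))
    (N : ℕ) (hN : 1 ≤ N)
    (st : ℕ → K)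
    (hst : ∀ μ : ℕ, 1 ≤ μ → μ ≤ N → st μ = (σ ^ (N - μ)) (s (N - μ + 1)))
    (d : ℕ) (lam : ℕ → K) :
    ∀ l : ℕ, d + 1 ≤ l → l ≤ N →
      ∑ ν ∈ Finset.Icc 1 (d + 1), lam ν * (σ.symm ^ (ν - 1)) (st (l - ν + 1))
        = ∑ i, ∑ r,
            (∑ ν ∈ Finset.Icc 1 (d + 1), lam ν * (σ.symm ^ (ν - 1)) (x i r) *
                ∏ j ∈ Finset.Icc 1 (ν - 1), (σ.symm ^ j) (ξ i))
            * (σ ^ (N - l)) (a i r) *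
              ∏ j ∈ Finset.range (N - l), (σ ^ j) (ξ i) := by
  intro l hdl hlN
  have hterm : ∀ ν ∈ Finset.Icc 1 (d + 1),
      lam ν * (σ.symm ^ (ν - 1)) (st (l - ν + 1)) = ∑ i, ∑ r,
        (lam ν * (σ.symm ^ (ν - 1)) (x i r) *
            ∏ j ∈ Finset.Icc 1 (ν - 1), (σ.symm ^ j) (ξ i))
          * (σ ^ (N - l)) (a i r) * ∏ j ∈ Finset.range (N - l), (σ ^ j) (ξ i) := by
    intro ν hν
    rw [Finset.mem_Icc] at hν
    rw [hst _ (by omega) (by omega), hs _ (by omega),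
      show N - (l - ν + 1) = N - l + (ν - 1) by omega, symm_pow_apply_pow_add]
    simp only [Nat.add_sub_cancel, map_sum, Finset.mul_sum]
    refine Finset.sum_congr rfl fun i _ => Finset.sum_congr rfl fun r _ => ?_
    rw [map_mul, map_mul, pow_map_prod_Icc_symm_pow, pow_apply_symm_pow_add]
    ring
  rw [Finset.sum_congr rfl hterm, Finset.sum_comm]
  refine Finset.sum_congr rfl fun i _ => ?_
  rw [Finset.sum_comm]
  refine Finset.sum_congr rfl fun r _ => ?_
  rw [Finset.sum_mul, Finset.sum_mul]
end

section
/- ELP key equation (Theorem 2): fix an integer N ≥ 1 (in the paper N = n−k) and define the reversed syndrome s̃_μ := σ^{N-μ}(s_{N-μ+1}) for μ = 1, …, N. For each i partition {1, …, t_i} into sets F_i, R_i, C_i of sizes t_{F,i}, ρ_i, γ_i and put t_F = Σ_i t_{F,i}, ρ = Σ_i ρ_i, γ = Σ_i γ_i. Let Σ_{F,1}, …, Σ_{F,t_F+1} ∈ K and Σ_{C,1}, …, Σ_{C,γ+1} ∈ K and define their skew product with respect to σ^{-1} by λ_ν := Σ_{μ} Σ_{F,μ} · σ^{-(μ-1)}(Σ_{C,ν-μ+1})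 for ν = 1, …, t_F+γ+1, and let Σ_{R,1}, …, Σ_{R,ρ+1} ∈ K. Assume: (i) Σ_{ν=1}^{t_F+γ+1} λ_ν · σ^{-(ν-1)}(x_r^{(i)}) · ∏_{j=1}^{ν-1} σ^{-j}(ξ_i) = 0 for every i and every r ∈ F_i ∪ C_i; and (ii) Σ_{μ=1}^{ρ+1} Σ_{R,μ} · σ^{-(μ-1)}(a_r^{(i)}) · ∏_{j=1}^{μ-1} σ^{-j}(ξ_i)^{-1} = 0 for every i and every r ∈ R_i. Then, with w_μ := Σ_{ν=1}^{t_F+γ+1} λ_ν · σ^{-(ν-1)}(s̃_{μ-ν+1}), for every integer l with t_F+ρ+γ+1 ≤ l ≤ N: Σ_{ν=1}^{ρ+1} w_{l-ν+1} · σ^{N+ρ-l}(Σ_{R,ρ-ν+2}) = 0. Equivalently, the skew product Σ_F · (Σ_C · s̃ · Ω_R) with respect to σ^{-1}, where Ω_R has coefficients Ω_{R,ν} = σ^{N+ρ-ν}(Σ_{R,ρ-ν+2}) (the σ^{-1}-reverse of Σ_R with respect to ρ with σ^{N-1} applied to every coefficient), is congruent modulo x^N from the right to a skew polynomial ψ of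 degree less than t_F + ρ + γ. -/
section TruncatedNorm

variable {K : Type*} [Field K] (σ : K ≃+* K)

/-- The truncated norm `z · σ(z) ⋯ σ^{n-1}(z)`. -/
def truncNorm (n : ℕ) (z : K) : K := ∏ k ∈ Finset.range n, (σ ^ k) z

theorem symm_pow_pow_add_apply (n q : ℕ) (y : K) :
    (σ.symm ^ q) ((σ ^ (n + q)) y) = (σ ^ n) y := by
  induction q with
  | zero => rfl
  | succ q ih =>
    rw [← ih, ← add_assoc, pow_succ (σ.symm), pow_succ' σ (n + q)]
    simp [RingAut.mul_apply]

theorem pow_add_symm_pow_apply (n q : ℕ) (y : K) :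
    (σ ^ (n + q)) ((σ.symm ^ q) y) = (σ ^ n) y := by
  induction q with
  | zero => rfl
  | succ q ih =>
    rw [← ih, ← add_assoc, pow_succ' (σ.symm), pow_succ σ (n + q)]
    simp [RingAut.mul_apply]

theorem truncNorm_ne_zero (n : ℕ) {z : K} (hz : z ≠ 0) : truncNorm σ n z ≠ 0 :=
  Finset.prod_ne_zero_iff.mpr fun k _ => (map_ne_zero_iff _ (σ ^ k).injective).mpr hz

theorem truncNorm_add (n q : ℕ) (z : K) :
    truncNorm σ (n + q) z = truncNorm σ n z * (σ ^ n) (truncNorm σ q z) := by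
  simp only [truncNorm, Finset.prod_range_add, map_prod, pow_add, RingAut.mul_apply]

theorem symm_pow_truncNorm (q : ℕ) (z : K) :
    (σ.symm ^ q) (truncNorm σ q z) = ∏ j ∈ Finset.Icc 1 q, (σ.symm ^ j) z := by
  induction q with
  | zero => simp [truncNorm]
  | succ q ih =>
    have h := truncNorm_add σ 1 q z
    rw [add_comm 1 q] at h
    rw [Finset.prod_Icc_succ_top (by lia), ← ih, h, map_mul, mul_comm]
    simp [truncNorm, pow_succ, RingAut.mul_apply]

theorem symm_pow_truncNorm_add (n q : ℕ) (z : K) :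
    (σ.symm ^ q) (truncNorm σ (n + q) z) =
      truncNorm σ n z * ∏ j ∈ Finset.Icc 1 q, (σ.symm ^ j) z := by
  rw [add_comm, truncNorm_add, map_mul, symm_pow_truncNorm, mul_comm]
  have h := symm_pow_pow_add_apply σ 0 q (truncNorm σ n z)
  rw [zero_add, pow_zero, RingAut.one_apply] at h
  rw [h]

theorem pow_add_prod_symm_pow (n q : ℕ) (z : K) :
    (σ ^ (n + q)) (∏ j ∈ Finset.Icc 1 q, (σ.symm ^ j) z) = (σ ^ n) (truncNorm σ q z) := by
  rw [← symm_pow_truncNorm, pow_add_symm_pow_apply]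

end TruncatedNorm

/-- ELP key equation (Theorem 2).  With the reversed syndrome `s̃_μ = σ^{N-μ}(s_{N-μ+1})`
for `1 ≤ μ ≤ N`, the error indices of each block `i` partitioned into full errors `FS i`,
row erasures `RS i` and column erasures `CS i` of total sizes `tF`, `ρ`, `γ`, and `lam`
the skew product (w.r.t. `σ⁻¹`) of `SF` and `SC` (where `SC` vanishes outside `[1, γ+1]`),
assume (i) `lam` vanishes under generalized operator evaluation (w.r.t. `σ⁻¹`, parameter
`σ⁻¹(ξ_i)`) at the error locators of full errors and column erasures, and (ii) `SR`
vanishes at the error values of the row erasures (parameter `σ⁻¹(ξ_i⁻¹)`).  Then, with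
`w μ` the `μ`-th coefficient of the skew product of `lam` with the reversed syndrome, all
coefficients of index `tF + ρ + γ + 1 ≤ l ≤ N` of `SF · (SC · s̃ · Ω_R)` vanish, i.e.
this product is congruent mod `x^N` (from the right) to a skew polynomial of degree less
than `tF + ρ + γ`. -/
theorem elp_key_equation {K : Type*} [Field K] (σ : K ≃+* K)
    (ℓ : ℕ) (t : Fin ℓ → ℕ)
    (ξ : Fin ℓ → K) (hξ : ∀ i, ξ i ≠ 0)
    (a x : (i : Fin ℓ) → Fin (t i) → K)
    (s : ℕ → K)
    (hs : ∀ l : ℕ, 1 ≤ l → s l =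
      ∑ i, ∑ r, a i r * (σ.symm ^ (l - 1)) (x i r) *
        ∏ j ∈ Finset.Icc 1 (l - 1), (σ.symm ^ j) (ξ i))
    (N : ℕ) (hN : 1 ≤ N)
    (st : ℕ → K)
    (hst : ∀ μ : ℕ, 1 ≤ μ → μ ≤ N → st μ = (σ ^ (N - μ)) (s (N - μ + 1)))
    (FS RS CS : (i : Fin ℓ) → Finset (Fin (t i)))
    (hpart : ∀ i, FS i ∪ RS i ∪ CS i = Finset.univ)
    (hFR : ∀ i, Disjoint (FS i) (RS i))
    (hFC : ∀ i, Disjoint (FS i) (CS i))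
    (hRC : ∀ i, Disjoint (RS i) (CS i))
    (tF ρ γ : ℕ)
    (htF : tF = ∑ i, (FS i).card) (hρ : ρ = ∑ i, (RS i).card)
    (hγ : γ = ∑ i, (CS i).card)
    (SF SC SR lam : ℕ → K)
    (hSC : ∀ μ : ℕ, μ = 0 ∨ γ + 1 < μ → SC μ = 0)
    (hlam : ∀ ν ∈ Finset.Icc 1 (tF + γ + 1),
      lam ν = ∑ μ ∈ Finset.Icc 1 (tF + 1), SF μ * (σ.symm ^ (μ - 1)) (SC (ν + 1 - μ)))
    (hi : ∀ i, ∀ r ∈ FS i ∪ CS i,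
      ∑ ν ∈ Finset.Icc 1 (tF + γ + 1), lam ν * (σ.symm ^ (ν - 1)) (x i r) *
        ∏ j ∈ Finset.Icc 1 (ν - 1), (σ.symm ^ j) (ξ i) = 0)
    (hii : ∀ i, ∀ r ∈ RS i,
      ∑ μ ∈ Finset.Icc 1 (ρ + 1), SR μ * (σ.symm ^ (μ - 1)) (a i r) *
        ∏ j ∈ Finset.Icc 1 (μ - 1), ((σ.symm ^ j) (ξ i))⁻¹ = 0)
    (w : ℕ → K)
    (hw : ∀ μ : ℕ, tF + γ + 1 ≤ μ → μ ≤ N → w μ =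
      ∑ ν ∈ Finset.Icc 1 (tF + γ + 1), lam ν * (σ.symm ^ (ν - 1)) (st (μ - ν + 1))) :
    ∀ l : ℕ, tF + ρ + γ + 1 ≤ l → l ≤ N →
      ∑ ν ∈ Finset.Icc 1 (ρ + 1),
        w (l - ν + 1) * (σ ^ (N + ρ - l)) (SR (ρ + 2 - ν)) = 0 := by
  intro l hl hlN
  have st_eq : ∀ n, n < N → st (N - n) =
      ∑ i, ∑ r, (σ ^ n) (a i r) * x i r * truncNorm σ n (ξ i) := by
    intro n hn
    rw [hst _ (by lia) (by lia), show N - (N - n) = n by lia, hs _ (by lia)]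
    simp only [map_sum, map_mul, Nat.add_sub_cancel]
    refine Finset.sum_congr rfl fun i _ => Finset.sum_congr rfl fun r _ => ?_
    have h1 := pow_add_symm_pow_apply σ 0 n (x i r)
    have h2 := pow_add_prod_symm_pow σ 0 n (ξ i)
    rw [zero_add, pow_zero, RingAut.one_apply] at h1 h2
    rw [h1, h2]
  have w_eq : ∀ n, n + (tF + γ + 1) ≤ N → w (N - n) =
      ∑ i, ∑ r, (σ ^ n) (a i r) * truncNorm σ n (ξ i) *
        ∑ ν ∈ Finset.Icc 1 (tF + γ + 1), lam ν * (σ.symm ^ (ν - 1)) (x i r) *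
          ∏ j ∈ Finset.Icc 1 (ν - 1), (σ.symm ^ j) (ξ i) := by
    intro n hn
    rw [hw _ (by lia) (by lia)]
    simp only [Finset.mul_sum]
    rw [Finset.sum_congr rfl fun i _ => Finset.sum_comm, Finset.sum_comm]
    refine Finset.sum_congr rfl fun ν hν => ?_
    rw [Finset.mem_Icc] at hν
    rw [show N - n - ν + 1 = N - (n + (ν - 1)) by lia, st_eq _ (by lia)]
    simp only [map_sum, map_mul, Finset.mul_sum, symm_pow_pow_add_apply,
      symm_pow_truncNorm_add]
    refine Finset.sum_congr rfl fun i _ => Finset.sum_congr rfl fun r _ => ?_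
    ring
  have row_eq : ∀ i, ∀ r ∈ RS i, ∑ ν ∈ Finset.Icc 1 (ρ + 1),
      (σ ^ (N - l + (ν - 1))) (a i r) * truncNorm σ (N - l + (ν - 1)) (ξ i) *
        (σ ^ (N + ρ - l)) (SR (ρ + 2 - ν)) = 0 := by
    intro i r hr
    have h := congrArg (fun y => (σ ^ (N + ρ - l)) y * truncNorm σ (N + ρ - l) (ξ i))
      (hii i r hr)
    simp only [map_zero, zero_mul, map_sum, Finset.sum_mul] at h
    rw [← h]
    refine Finset.sum_bij' (fun ν _ => ρ + 2 - ν) (fun ν _ => ρ + 2 - ν) ?_ ?_ ?_ ?_ ?_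
    any_goals intro ν hν; simp only [Finset.mem_Icc] at hν ⊢; lia
    intro ν hν
    rw [Finset.mem_Icc] at hν
    obtain ⟨n, hn⟩ : ∃ n, n = N - l + (ν - 1) := ⟨_, rfl⟩
    rw [← hn, show N + ρ - l = n + (ρ + 2 - ν - 1) by lia]
    generalize ρ + 2 - ν - 1 = q
    rw [map_mul, map_mul, pow_add_symm_pow_apply, Finset.prod_inv_distrib, map_inv₀,
      pow_add_prod_symm_pow, truncNorm_add]
    have h0 : (σ ^ n) (truncNorm σ q (ξ i)) ≠ 0 :=
      (map_ne_zero_iff _ (σ ^ n).injective).mpr (truncNorm_ne_zero σ q (hξ i))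
    field_simp
  have sum_eq : ∀ ν ∈ Finset.Icc 1 (ρ + 1),
      w (l - ν + 1) * (σ ^ (N + ρ - l)) (SR (ρ + 2 - ν)) =
      ∑ i, ∑ r, ((σ ^ (N - l + (ν - 1))) (a i r) * truncNorm σ (N - l + (ν - 1)) (ξ i) *
          (σ ^ (N + ρ - l)) (SR (ρ + 2 - ν))) *
        ∑ ν ∈ Finset.Icc 1 (tF + γ + 1), lam ν * (σ.symm ^ (ν - 1)) (x i r) *
          ∏ j ∈ Finset.Icc 1 (ν - 1), (σ.symm ^ j) (ξ i) := by
    intro ν hν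
    rw [Finset.mem_Icc] at hν
    rw [show l - ν + 1 = N - (N - l + (ν - 1)) by lia, w_eq _ (by lia)]
    simp only [Finset.sum_mul _ _ ((σ ^ (N + ρ - l)) (SR (ρ + 2 - ν)))]
    refine Finset.sum_congr rfl fun i _ => Finset.sum_congr rfl fun r _ => ?_
    ring
  rw [Finset.sum_congr rfl sum_eq, Finset.sum_comm]
  refine Finset.sum_eq_zero fun i _ => ?_
  rw [Finset.sum_comm]
  refine Finset.sum_eq_zero fun r _ => ?_
  rw [← Finset.sum_mul]
  have hr : r ∈ FS i ∪ RS i ∪ CS i := hpart i ▸ Finset.mem_univ r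
  by_cases hR : r ∈ RS i
  · rw [row_eq i r hR, zero_mul]
  · rw [hi i r (by simp only [Finset.mem_union] at hr ⊢; tauto), mul_zero]
end

section
/- Sum-rank weight bound for an error–erasure difference: let e = e_F + e_R + e_C and e' = e'_F + e'_R + e'_C be vectors in K^n, written blockwise with respect to the length partition n = n_1 + ⋯ + n_ℓ. Assume: (i) wt_ΣR(e_F) ≤ t_F and wt_ΣR(e'_F) ≤ t_F; (ii) for each i there is an F-subspace V_i ⊆ K with dim_F V_i ≤ ρ_i such that every entry of e_R^{(i)} and every entry of e'^{(i)}_R lies in V_i, and set ρ := Σ_{i=1}^ℓ ρ_i (row erasures: known column spaces); (iii) for each i there are vectors b_1^{(i)}, …, b_{γ_i}^{(i)} ∈ F^{n_i} such that both e_C^{(i)} and e'^{(i)}_C are K-linear combinations of b_1^{(i)}, …, b_{γ_i}^{(i)} (viewed inside K^{n_i}), and set γ := Σ_{i=1}^ℓ γ_i (column erasures: known row spaces). Then wt_ΣR(e − e') ≤ 2·t_F + ρ + γ. -/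
/-- The fixed subfield `F = {c : K | σ c = c}` of the automorphism `σ`. -/
def fixedSubfield (K : Type*) [Field K] (σ : K ≃+* K) : Subfield K where
  carrier := {c | σ c = c}
  mul_mem' := by intro p q hp hq; simp only [Set.mem_setOf_eq, map_mul] at *; rw [hp, hq]
  one_mem' := map_one σ
  add_mem' := by intro p q hp hq; simp only [Set.mem_setOf_eq, map_add] at *; rw [hp, hq]
  zero_mem' := map_zero σ
  neg_mem' := by intro p hp; simp only [Set.mem_setOf_eq, map_neg] at *; rw [hp]
  inv_mem' := by intro p hp; simp only [Set.mem_setOf_eq, map_inv₀] at *; rw [hp]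

/-- The `F`-rank of a vector over `K`: the dimension over the fixed subfield `F` of the
`F`-linear span of its entries. -/
noncomputable def rankF {K : Type*} [Field K] (σ : K ≃+* K) {m : ℕ} (v : Fin m → K) : ℕ :=
  Module.finrank (fixedSubfield K σ)
    (Submodule.span (fixedSubfield K σ) (Set.range v))

/-- The `F`-rank of a vector is at most the dimension of any finite-dimensional `F`-subspace
containing its entries. -/
theorem rankF_le_finrank {K : Type*} [Field K] {σ : K ≃+* K} {m : ℕ} {v : Fin m → K}
    (V : Submodule (fixedSubfield K σ) K) [FiniteDimensional (fixedSubfield K σ) V]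
    (hv : ∀ k, v k ∈ V) : rankF σ v ≤ Module.finrank (fixedSubfield K σ) V :=
  Submodule.finrank_mono (Submodule.span_le.2 (Set.range_subset_iff.2 hv))

theorem rankF_add_le {K : Type*} [Field K] (σ : K ≃+* K) {m : ℕ} (v w : Fin m → K) :
    rankF σ (v + w) ≤ rankF σ v + rankF σ w := by
  have := FiniteDimensional.span_of_finite (fixedSubfield K σ) (Set.finite_range v)
  have := FiniteDimensional.span_of_finite (fixedSubfield K σ) (Set.finite_range w)
  exact (rankF_le_finrank (Submodule.span _ (Set.range v) ⊔ Submodule.span _ (Set.range w))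
    fun k => Submodule.add_mem_sup (Submodule.subset_span ⟨k, rfl⟩)
      (Submodule.subset_span ⟨k, rfl⟩)).trans (Submodule.finrank_add_le_finrank_add_finrank _ _)

theorem rankF_neg_le {K : Type*} [Field K] (σ : K ≃+* K) {m : ℕ} (v : Fin m → K) :
    rankF σ (-v) ≤ rankF σ v := by
  have := FiniteDimensional.span_of_finite (fixedSubfield K σ) (Set.finite_range v)
  exact rankF_le_finrank _ fun k => neg_mem (Submodule.subset_span ⟨k, rfl⟩)

/-- A `K`-linear combination of `g` vectors with entries in `F` has `F`-rank at most `g`. -/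
theorem rankF_le_of_mem_span {K : Type*} [Field K] {σ : K ≃+* K} {m g : ℕ}
    {b : Fin g → Fin m → K} (hb : ∀ j k, σ (b j k) = b j k) {v : Fin m → K}
    (hv : v ∈ Submodule.span K (Set.range b)) : rankF σ v ≤ g := by
  obtain ⟨c, rfl⟩ := (Submodule.mem_span_range_iff_exists_fun K).1 hv
  have := FiniteDimensional.span_of_finite (fixedSubfield K σ) (Set.finite_range c)
  refine (rankF_le_finrank (Submodule.span _ (Set.range c)) fun k => ?_).trans
    ((finrank_range_le_card c).trans_eq (Fintype.card_fin g))
  rw [Finset.sum_apply]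
  refine Submodule.sum_mem _ fun j _ => ?_
  have h := Submodule.smul_mem (Submodule.span (fixedSubfield K σ) (Set.range c))
    (⟨b j k, hb j k⟩ : fixedSubfield K σ) (Submodule.subset_span ⟨j, rfl⟩)
  rwa [Subfield.smul_def, smul_eq_mul, mul_comm] at h

/-- Sum-rank weight bound for an error–erasure difference: if `e = e_F + e_R + e_C` and
`e' = e'_F + e'_R + e'_C` (blockwise w.r.t. the length partition `n = n_1 + ⋯ + n_ℓ`),
where the full-error parts have sum-rank weight at most `t_F`, the row-erasure parts of
block `i` have all entries in a common `F`-subspace `V_i ⊆ K` of dimension at most `ρ_i`,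
and the column-erasure parts of block `i` are `K`-linear combinations of common vectors
`b_1^{(i)}, …, b_{γ_i}^{(i)} ∈ F^{n_i}`, then `wt_ΣR(e − e') ≤ 2 t_F + ρ + γ`. -/
theorem sum_rank_weight_error_erasure_difference {K : Type*} [Field K] (σ : K ≃+* K)
    (ℓ : ℕ) (n : Fin ℓ → ℕ)
    (tF : ℕ) (ρi γi : Fin ℓ → ℕ)
    (e e' eF eR eC eF' eR' eC' : (i : Fin ℓ) → Fin (n i) → K)
    (he : e = eF + eR + eC) (he' : e' = eF' + eR' + eC')
    (hF : ∑ i, rankF σ (eF i) ≤ tF) (hF' : ∑ i, rankF σ (eF' i) ≤ tF)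
    (hR : ∀ i, ∃ V : Submodule (fixedSubfield K σ) K,
      Module.rank (fixedSubfield K σ) V ≤ (ρi i : Cardinal) ∧
      (∀ κ, eR i κ ∈ V) ∧ (∀ κ, eR' i κ ∈ V))
    (hC : ∀ i, ∃ b : Fin (γi i) → (Fin (n i) → K),
      (∀ j κ, σ (b j κ) = b j κ) ∧
      eC i ∈ Submodule.span K (Set.range b) ∧
      eC' i ∈ Submodule.span K (Set.range b)) :
    ∑ i, rankF σ ((e - e') i) ≤ 2 * tF + (∑ i, ρi i) + (∑ i, γi i) := by
  have block_le (i : Fin ℓ) : rankF σ ((e - e') i) ≤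
      rankF σ (eF i) + rankF σ (eF' i) + ρi i + γi i := by
    obtain ⟨V, hV, hRV, hRV'⟩ := hR i
    obtain ⟨b, hb, hCb, hCb'⟩ := hC i
    have : FiniteDimensional (fixedSubfield K σ) V :=
      Module.rank_lt_aleph0_iff.1 (hV.trans_lt Cardinal.natCast_lt_aleph0)
    have row_le : rankF σ (eR i - eR' i) ≤ ρi i :=
      (rankF_le_finrank V fun k => sub_mem (hRV k) (hRV' k)).trans
        (Module.finrank_le_of_rank_le hV)
    have col_le : rankF σ (eC i - eC' i) ≤ γi i := rankF_le_of_mem_span hb (sub_mem hCb hCb')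
    have split : (e - e') i = eF i + -eF' i + (eR i - eR' i) + (eC i - eC' i) := by
      subst he he'
      simp only [Pi.sub_apply, Pi.add_apply]
      abel
    rw [split]
    have h₁ := rankF_add_le σ (eF i + -eF' i + (eR i - eR' i)) (eC i - eC' i)
    have h₂ := rankF_add_le σ (eF i + -eF' i) (eR i - eR' i)
    have h₃ := rankF_add_le σ (eF i) (-eF' i)
    have h₄ := rankF_neg_le σ (eF' i)
    omega
  have total := Finset.sum_le_sum fun i (_ : i ∈ Finset.univ) => block_le i
  simp only [Finset.sum_add_distrib] at total
  omega
end
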